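/- arXiv:1806.08344 — 13 statements merged into one kernel-verified Lean document; each statement's English description precedes it below -/
import Mathlib

section
/- Let θ₀, θ_t, θ_* ∈ ℂ, let U ⊆ ℂ ∖ {0} be open, and let x, y, u : U → ℂ be holomorphic with y and u nowhere vanishing on U, satisfying for all t ∈ U the system: t·x'(t) = (x−θ₀)(x−θ_t−θ_*)·y − (x+θ₀)(x+θ_t−θ_*)/y, t·y'(t) = (θ₀+θ_t+θ_*−2x)(y−1)² + 2(θ₀+θ_t)(y−1) + t·y, and t·u'(t)/u(t) = (x−θ_t−θ_*)·y + (x+θ_t−θ_*)/y − 2x. Then the zero-curvature equation ∂_t A(z,t) − ∂_z B(z,t) = A(z,t)·B(z,t) − B(z,t)·A(z,t) holds for every t ∈ U and every z ∈ ℂ ∖ {0,1}. -/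
open Matrix Complex

/-- The Pauli matrix `σ_z = diag(1, -1)`. -/
noncomputable def sigmaZ : Matrix (Fin 2) (Fin 2) ℂ := !![1, 0; 0, -1]

/-- The matrix `A(z,t)` of the Painlevé V Lax pair. -/
noncomputable def pvA (θ0 θt θs : ℂ) (x y u : ℂ → ℂ) (z t : ℂ) :
    Matrix (Fin 2) (Fin 2) ℂ :=
  (t / 2) • sigmaZ
    + (1 / z) • !![x t, (x t - θ0) / u t; -(u t) * (x t + θ0), -(x t)]
    + (1 / (z - 1)) • !![θs - x t, -(x t + θt - θs) / (u t * y t);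
        u t * y t * (x t - θt - θs), x t - θs]

/-- The matrix `B(z,t)` of the Painlevé V Lax pair. -/
noncomputable def pvB (θ0 θt θs : ℂ) (x y u : ℂ → ℂ) (z t : ℂ) :
    Matrix (Fin 2) (Fin 2) ℂ :=
  (z / 2) • sigmaZ
    + !![0, (x t * (y t - 1) - θ0 * y t - θt + θs) / (t * u t * y t);
        (x t * (y t - 1) - (θs + θt) * y t - θ0) * u t / t, 0]

/-- The Painlevé V system implies the zero-curvature equation
`∂_t A − ∂_z B = [A, B]`. -/
theorem zero_curvature_of_painleveV_system
    (θ0 θt θs : ℂ) (U : Set ℂ) (hU : IsOpen U) (hU0 : ∀ t ∈ U, t ≠ 0)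
    (x y u : ℂ → ℂ)
    (hx : DifferentiableOn ℂ x U) (hy : DifferentiableOn ℂ y U)
    (hu : DifferentiableOn ℂ u U)
    (hy0 : ∀ t ∈ U, y t ≠ 0) (hu0 : ∀ t ∈ U, u t ≠ 0)
    (hode1 : ∀ t ∈ U, t * deriv x t =
      (x t - θ0) * (x t - θt - θs) * y t - (x t + θ0) * (x t + θt - θs) / y t)
    (hode2 : ∀ t ∈ U, t * deriv y t =
      (θ0 + θt + θs - 2 * x t) * (y t - 1) ^ 2 + 2 * (θ0 + θt) * (y t - 1) + t * y t)
    (hode3 : ∀ t ∈ U, t * deriv u t / u t =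
      (x t - θt - θs) * y t + (x t + θt - θs) / y t - 2 * x t) :
    ∀ t ∈ U, ∀ z : ℂ, z ≠ 0 → z ≠ 1 →
      (Matrix.of fun i j => deriv (fun s => pvA θ0 θt θs x y u z s i j) t)
        - (Matrix.of fun i j => deriv (fun w => pvB θ0 θt θs x y u w t i j) z)
      = pvA θ0 θt θs x y u z t * pvB θ0 θt θs x y u z t
        - pvB θ0 θt θs x y u z t * pvA θ0 θt θs x y u z t := by
  intro t ht z hz hz1
  have hz1' : z - 1 ≠ 0 := sub_ne_zero.mpr hz1
  have ht0 := hU0 t ht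
  have hyt := hy0 t ht
  have hut := hu0 t ht
  have dx := (hx.differentiableAt (hU.mem_nhds ht)).hasDerivAt
  have dy := (hy.differentiableAt (hU.mem_nhds ht)).hasDerivAt
  have du := (hu.differentiableAt (hU.mem_nhds ht)).hasDerivAt
  have e1 : deriv x t = ((x t - θ0) * (x t - θt - θs) * y t
      - (x t + θ0) * (x t + θt - θs) / y t) / t := by
    rw [← hode1 t ht]; field_simp
  have e2 : deriv y t = ((θ0 + θt + θs - 2 * x t) * (y t - 1) ^ 2
      + 2 * (θ0 + θt) * (y t - 1) + t * y t) / t := by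
    rw [← hode2 t ht]; field_simp
  have e3 : deriv u t = ((x t - θt - θs) * y t + (x t + θt - θs) / y t - 2 * x t) * u t / t := by
    rw [← hode3 t ht]; field_simp
  rw [e1] at dx
  rw [e2] at dy
  rw [e3] at du
  clear e1 e2 e3 hode1 hode2 hode3
  have hid := hasDerivAt_id' t
  have hidz := hasDerivAt_id' z
  have a00 := ((hid.div_const 2).add (dx.const_mul (1 / z))).add
    ((dx.const_sub θs).const_mul (1 / (z - 1)))
  have a01 := (((dx.sub_const θ0).div du hut).const_mul (1 / z)).add
    ((((dx.add_const θt).sub_const θs).neg.div (du.mul dy)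
      (mul_ne_zero hut hyt)).const_mul (1 / (z - 1)))
  have a10 := ((du.neg.mul (dx.add_const θ0)).const_mul (1 / z)).add
    (((du.mul dy).mul ((dx.sub_const θt).sub_const θs)).const_mul (1 / (z - 1)))
  have a11 := ((hid.div_const 2).neg.add (dx.neg.const_mul (1 / z))).add
    ((dx.sub_const θs).const_mul (1 / (z - 1)))
  have b00 := hidz.div_const 2
  have b11 := (hidz.div_const 2).neg
  have A00 : (fun s => pvA θ0 θt θs x y u z s 0 0) = fun s =>
      s / 2 + 1 / z * x s + 1 / (z - 1) * (θs - x s) := by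
    funext s; simp [pvA, sigmaZ]
  have A01 : (fun s => pvA θ0 θt θs x y u z s 0 1) = fun s =>
      1 / z * ((x s - θ0) / u s) + 1 / (z - 1) * (-(x s + θt - θs) / (u s * y s)) := by
    funext s; simp [pvA, sigmaZ]
  have A10 : (fun s => pvA θ0 θt θs x y u z s 1 0) = fun s =>
      1 / z * (-(u s) * (x s + θ0)) + 1 / (z - 1) * (u s * y s * (x s - θt - θs)) := by
    funext s; simp [pvA, sigmaZ]
  have A11 : (fun s => pvA θ0 θt θs x y u z s 1 1) = fun s =>
      -(s / 2) + 1 / z * (-(x s)) + 1 / (z - 1) * (x s - θs) := by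
    funext s; simp [pvA, sigmaZ]
  have B00 : (fun w => pvB θ0 θt θs x y u w t 0 0) = fun w => w / 2 := by
    funext s; simp [pvB, sigmaZ]
  have B01 : (fun w => pvB θ0 θt θs x y u w t 0 1) = fun _ =>
      (x t * (y t - 1) - θ0 * y t - θt + θs) / (t * u t * y t) := by
    funext s; simp [pvB, sigmaZ]
  have B10 : (fun w => pvB θ0 θt θs x y u w t 1 0) = fun _ =>
      (x t * (y t - 1) - (θs + θt) * y t - θ0) * u t / t := by
    funext s; simp [pvB, sigmaZ]
  have B11 : (fun w => pvB θ0 θt θs x y u w t 1 1) = fun w => -(w / 2) := by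
    funext s; simp [pvB, sigmaZ]
  have D00 := (congrArg (fun f => deriv f t) A00).trans a00.deriv
  have D01 := (congrArg (fun f => deriv f t) A01).trans a01.deriv
  have D10 := (congrArg (fun f => deriv f t) A10).trans a10.deriv
  have D11 := (congrArg (fun f => deriv f t) A11).trans a11.deriv
  have E00 := (congrArg (fun f => deriv f z) B00).trans b00.deriv
  have E01 := (congrArg (fun f => deriv f z) B01).trans (deriv_const z _)
  have E10 := (congrArg (fun f => deriv f z) B10).trans (deriv_const z _)
  have E11 := (congrArg (fun f => deriv f z) B11).trans b11.deriv
  have A00 := congrFun A00 t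
  have A01 := congrFun A01 t
  have A10 := congrFun A10 t
  have A11 := congrFun A11 t
  have B00 := congrFun B00 z
  have B01 := congrFun B01 z
  have B10 := congrFun B10 z
  have B11 := congrFun B11 z
  beta_reduce at A00 A01 A10 A11 B00 B01 B10 B11 D00 D01 D10 D11 E00 E01 E10 E11
  simp only [Pi.add_apply, Pi.neg_apply, Pi.mul_apply] at D00 D01 D10 D11
  clear a00 a01 a10 a11 b00 b11 dx dy du hx hy hu
  generalize x t = X at *
  generalize y t = Y at *
  generalize u t = V at *
  ext i j
  fin_cases i <;> fin_cases j <;>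
    simp only [Fin.zero_eta, Fin.mk_one, Fin.isValue, Matrix.sub_apply, Matrix.of_apply,
      Matrix.mul_apply, Fin.sum_univ_two, D00, D01, D10, D11, E00, E01, E10, E11,
      A00, A01, A10, A11, B00, B01, B10, B11]
  · field_simp
    ring
  · field_simp
    ring
  · field_simp
    ring
  · field_simp
    ring
end

section
/- Let θ₀, θ_t, θ_* ∈ ℂ, let U ⊆ ℂ ∖ {0} be open, and let x, y : U → ℂ be holomorphic with y(t) ∉ {0, 1} for all t ∈ U, satisfying for all t ∈ U: t·x'(t) = (x−θ₀)(x−θ_t−θ_*)·y − (x+θ₀)(x+θ_t−θ_*)/y and t·y'(t) = (θ₀+θ_t+θ_*−2x)(y−1)² + 2(θ₀+θ_t)(y−1) + t·y. Then y satisfies the Painlevé V equation y'' = (1/(2y) + 1/(y−1))·(y')² − y'/t + ((y−1)²/t²)·(α·y + β/y) + γ·y/t + δ·y·(y+1)/(y−1) on U, with parameters α = (θ₀−θ_t−θ_*)²/2, β = −(θ₀−θ_t+θ_*)²/2, γ = 1−2θ₀−2θ_t, δ = −1/2. -/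
open Complex

/-- The first-order Painlevé V system for `(x, y)` implies the standard
Painlevé V equation for `y`, with parameters
`α = (θ₀−θ_t−θ_*)²/2`, `β = −(θ₀−θ_t+θ_*)²/2`, `γ = 1−2θ₀−2θ_t`, `δ = −1/2`. -/
theorem painleveV_of_system
    (θ0 θt θs : ℂ) (U : Set ℂ) (hU : IsOpen U) (hU0 : ∀ t ∈ U, t ≠ 0)
    (x y : ℂ → ℂ)
    (hx : DifferentiableOn ℂ x U) (hy : DifferentiableOn ℂ y U)
    (hy0 : ∀ t ∈ U, y t ≠ 0) (hy1 : ∀ t ∈ U, y t ≠ 1)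
    (hode1 : ∀ t ∈ U, t * deriv x t =
      (x t - θ0) * (x t - θt - θs) * y t - (x t + θ0) * (x t + θt - θs) / y t)
    (hode2 : ∀ t ∈ U, t * deriv y t =
      (θ0 + θt + θs - 2 * x t) * (y t - 1) ^ 2 + 2 * (θ0 + θt) * (y t - 1) + t * y t) :
    ∀ t ∈ U,
      deriv (deriv y) t =
        (1 / (2 * y t) + 1 / (y t - 1)) * (deriv y t) ^ 2 - deriv y t / t
          + ((y t - 1) ^ 2 / t ^ 2) *
              (((θ0 - θt - θs) ^ 2 / 2) * y t + (-((θ0 - θt + θs) ^ 2 / 2)) / y t)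
          + (1 - 2 * θ0 - 2 * θt) * y t / t
          + (-(1 / 2)) * y t * (y t + 1) / (y t - 1) := by
  intro t ht
  have ht0 := hU0 t ht
  have h0 := hy0 t ht
  have h1 : y t - 1 ≠ 0 := sub_ne_zero.mpr (hy1 t ht)
  have hn : U ∈ nhds t := hU.mem_nhds ht
  have hxd := (hx.differentiableAt hn).hasDerivAt
  have hyd := (hy.differentiableAt hn).hasDerivAt
  have hydd := ((hy.deriv hU).differentiableAt hn).hasDerivAt
  have hL := (hasDerivAt_id t).mul hydd
  have hR := (((hxd.const_mul 2).const_sub (θ0 + θt + θs)).mul ((hyd.sub_const 1).pow 2)).add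
    ((hyd.sub_const 1).const_mul (2 * (θ0 + θt))) |>.add ((hasDerivAt_id t).mul hyd)
  have hev := hR.congr_of_eventuallyEq
    (f₁ := id * deriv y) (by
      filter_upwards [hn] with u hu
      simpa using hode2 u hu)
  have key := hL.unique hev
  have e1 := hode1 t ht
  have e2 := hode2 t ht
  simp at key
  generalize deriv (deriv y) t = Y2 at *
  generalize deriv y t = Y1 at *
  generalize deriv x t = X1 at *
  generalize y t = Y at *
  generalize x t = X at *
  clear hL hR hev hxd hyd hydd
  have hX : X1 = ((X - θ0) * (X - θt - θs) * Y - (X + θ0) * (X + θt - θs) / Y) / t := by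
    rw [← e1]; field_simp
  have hY : Y1 = ((θ0 + θt + θs - 2 * X) * (Y - 1) ^ 2 + 2 * (θ0 + θt) * (Y - 1) + t * Y) / t := by
    rw [← e2]; field_simp
  have hY2 : Y2 = (-2 * X1 * (Y - 1) ^ 2 + 2 * (θ0 + θt + θs - 2 * X) * (Y - 1) * Y1
      + 2 * (θ0 + θt) * Y1 + Y + t * Y1 - Y1) / t := by
    field_simp
    linear_combination key
  rw [hY2, hX, hY]
  field_simp
  ring
end

section
/- Let θ₀, θ_t, θ_* ∈ ℂ, let U ⊆ ℂ ∖ {0} be open, and let x, y : U → ℂ be holomorphic with y(t) ∉ {0, 1} for all t ∈ U, satisfying for all t ∈ U: t·x'(t) = (x−θ₀)(x−θ_t−θ_*)·y − (x+θ₀)(x+θ_t−θ_*)/y and t·y'(t) = (θ₀+θ_t+θ_*−2x)(y−1)² + 2(θ₀+θ_t)(y−1) + t·y. Define H(t) = (x−θ₀)(x−θ_t−θ_*)·y + (x+θ₀)(x+θ_t−θ_*)/y − (2x−θ_*+t)(2x−θ_*)/2. Then H satisfies the σ-form of Painlevé V with parameters (θ₀, θ_t, θ_*) on U. -/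
open Complex

/-- `H` satisfies the σ-form of Painlevé V with parameters `(θ₀, θ_t, θ_*)` on `U`:
`(t H'')² = (H − t H' + 2 H'²)² − (1/4)((2H'−θ_*)² − 4θ₀²)((2H'+θ_*)² − 4θ_t²)`. -/
def SigmaPV (θ0 θt θs : ℂ) (U : Set ℂ) (H : ℂ → ℂ) : Prop :=
  ∀ t ∈ U, (t * deriv (deriv H) t) ^ 2 =
    (H t - t * deriv H t + 2 * (deriv H t) ^ 2) ^ 2
      - (1 / 4) * ((2 * deriv H t - θs) ^ 2 - 4 * θ0 ^ 2)
        * ((2 * deriv H t + θs) ^ 2 - 4 * θt ^ 2)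

/-- The Hamiltonian `H` built from a solution `(x, y)` of the first-order Painlevé V
system satisfies the σ-form of Painlevé V. -/
theorem sigmaPV_of_system
    (θ0 θt θs : ℂ) (U : Set ℂ) (hU : IsOpen U) (hU0 : ∀ t ∈ U, t ≠ 0)
    (x y : ℂ → ℂ)
    (hx : DifferentiableOn ℂ x U) (hy : DifferentiableOn ℂ y U)
    (hy0 : ∀ t ∈ U, y t ≠ 0) (hy1 : ∀ t ∈ U, y t ≠ 1)
    (hode1 : ∀ t ∈ U, t * deriv x t =
      (x t - θ0) * (x t - θt - θs) * y t - (x t + θ0) * (x t + θt - θs) / y t)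
    (hode2 : ∀ t ∈ U, t * deriv y t =
      (θ0 + θt + θs - 2 * x t) * (y t - 1) ^ 2 + 2 * (θ0 + θt) * (y t - 1) + t * y t) :
    SigmaPV θ0 θt θs U (fun t =>
      (x t - θ0) * (x t - θt - θs) * y t + (x t + θ0) * (x t + θt - θs) / y t
        - (2 * x t - θs + t) * (2 * x t - θs) / 2) := by
  have key : ∀ t ∈ U, deriv (fun t =>
      (x t - θ0) * (x t - θt - θs) * y t + (x t + θ0) * (x t + θt - θs) / y t
        - (2 * x t - θs + t) * (2 * x t - θs) / 2) t = θs / 2 - x t := by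
    intro t ht
    have hxt : HasDerivAt x (deriv x t) t :=
      ((hx t ht).differentiableAt (hU.mem_nhds ht)).hasDerivAt
    have hyt : HasDerivAt y (deriv y t) t :=
      ((hy t ht).differentiableAt (hU.mem_nhds ht)).hasDerivAt
    have h0 := hy0 t ht
    have ht0 := hU0 t ht
    have hA := ((hxt.sub_const θ0).mul ((hxt.sub_const θt).sub_const θs)).mul hyt
    have hB := ((hxt.add_const θ0).mul ((hxt.add_const θt).sub_const θs)).div hyt h0
    have h2 := (hxt.const_mul 2).sub_const θs
    have hC := ((h2.add (hasDerivAt_id t)).mul h2).div_const 2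
    have hH := (hA.add hB).sub hC
    have e1 : deriv x t = ((x t - θ0) * (x t - θt - θs) * y t
        - (x t + θ0) * (x t + θt - θs) / y t) / t := by
      rw [← hode1 t ht]; field_simp
    have e2 : deriv y t = ((θ0 + θt + θs - 2 * x t) * (y t - 1) ^ 2
        + 2 * (θ0 + θt) * (y t - 1) + t * y t) / t := by
      rw [← hode2 t ht]; field_simp
    refine (HasDerivAt.deriv hH).trans ?_
    simp only [Pi.mul_apply, Pi.add_apply, id]
    rw [e1, e2]
    field_simp
    ring
  intro t ht
  have hxt : HasDerivAt x (deriv x t) t :=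
    ((hx t ht).differentiableAt (hU.mem_nhds ht)).hasDerivAt
  have hev := Filter.eventually_of_mem (hU.mem_nhds ht) key
  have hdd := Filter.EventuallyEq.deriv_eq hev
  rw [hdd, (hxt.const_sub (θs / 2)).deriv, key t ht, mul_neg, hode1 t ht]
  have h0 := hy0 t ht
  field_simp
  ring
end

section
/- Let σ, θ_* ∈ ℂ with σ + θ_* ∉ ℤ and σ − θ_* ∉ ℤ, and let ρ, T ∈ ℂ ∖ {0}. Define the Stokes multipliers s₁ = −2πi·ρ·T⁻¹ / (Γ(σ−θ_*)·Γ(1−σ−θ_*)) and s₂ = −2πi·ρ⁻¹·T·e^{−2πiθ_*} / (Γ(θ_*+σ)·Γ(1+θ_*−σ)), and the matrices S₁ = [[1, s₁],[0, 1]], S₂ = [[1, 0],[s₂, 1]]. Then Tr( S₁ · diag(e^{−2πiθ_*}, e^{2πiθ_*}) · S₂ ) = 2·cos(2πσ). -/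
open Complex Matrix Real

/-- The trace of the monodromy matrix at infinity of the Painlevé V linear system,
`M_∞ = S₁ · e^{−2πiθ_* σ_z} · S₂`, equals `2 cos 2πσ`. -/
theorem trace_monodromy_at_infinity
    (σ θs : ℂ)
    (h1 : ∀ n : ℤ, σ + θs ≠ (n : ℂ)) (h2 : ∀ n : ℤ, σ - θs ≠ (n : ℂ))
    (ρ T : ℂ) (hρ : ρ ≠ 0) (hT : T ≠ 0)
    (s1 s2 : ℂ)
    (hs1 : s1 = -2 * (π : ℂ) * I * ρ * T⁻¹ /
      (Complex.Gamma (σ - θs) * Complex.Gamma (1 - σ - θs)))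
    (hs2 : s2 = -2 * (π : ℂ) * I * ρ⁻¹ * T * Complex.exp (-2 * (π : ℂ) * I * θs) /
      (Complex.Gamma (θs + σ) * Complex.Gamma (1 + θs - σ))) :
    Matrix.trace
      (!![1, s1; 0, 1] *
        !![Complex.exp (-2 * (π : ℂ) * I * θs), 0; 0, Complex.exp (2 * (π : ℂ) * I * θs)] *
        !![1, 0; s2, 1])
      = 2 * Complex.cos (2 * (π : ℂ) * σ) := by
  have hpi : (π : ℂ) ≠ 0 := Complex.ofReal_ne_zero.mpr Real.pi_ne_zero
  have g1 := Complex.Gamma_mul_Gamma_one_sub (σ - θs)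
  have g2 := Complex.Gamma_mul_Gamma_one_sub (θs + σ)
  rw [show 1 - (σ - θs) = 1 + θs - σ by ring] at g1
  rw [show 1 - (θs + σ) = 1 - σ - θs by ring] at g2
  have hE : Complex.exp (-2 * (π : ℂ) * I * θs) * Complex.exp (2 * (π : ℂ) * I * θs) = 1 := by
    rw [← Complex.exp_add, ← Complex.exp_zero]
    congr 1
    ring
  have hcos : Complex.exp (-2 * (π : ℂ) * I * θs) + Complex.exp (2 * (π : ℂ) * I * θs)
      = 2 * Complex.cos (2 * (π : ℂ) * θs) := by
    rw [Complex.two_cos, add_comm]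
    congr 2 <;> ring
  have hprod : s1 * s2 * Complex.exp (2 * (π : ℂ) * I * θs)
      = -4 * (Complex.sin (π * (σ - θs)) * Complex.sin (π * (θs + σ))) := by
    have e1 : s1 * s2 * Complex.exp (2 * (π : ℂ) * I * θs) =
        4 * I ^ 2 * (ρ * ρ⁻¹) * (T⁻¹ * T) *
        (Complex.exp (-2 * (π : ℂ) * I * θs) * Complex.exp (2 * (π : ℂ) * I * θs)) *
        (π * (Complex.Gamma (σ - θs) * Complex.Gamma (1 + θs - σ))⁻¹) *
        (π * (Complex.Gamma (θs + σ) * Complex.Gamma (1 - σ - θs))⁻¹) := by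
      rw [hs1, hs2]
      simp only [div_eq_mul_inv, mul_inv]
      ring
    rw [e1, g1, g2, hE, mul_inv_cancel₀ hρ, inv_mul_cancel₀ hT, Complex.I_sq, inv_div, inv_div,
      mul_div_cancel₀ _ hpi, mul_div_cancel₀ _ hpi]
    ring
  have hsin : Complex.cos (2 * (π : ℂ) * σ) - Complex.cos (2 * (π : ℂ) * θs)
      = -2 * (Complex.sin (π * (σ - θs)) * Complex.sin (π * (θs + σ))) := by
    rw [show 2 * (π : ℂ) * σ = π * (θs + σ) + π * (σ - θs) by ring,
      show 2 * (π : ℂ) * θs = π * (θs + σ) - π * (σ - θs) by ring,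
      Complex.cos_add, Complex.cos_sub]
    ring
  simp only [Matrix.mul_fin_two, Matrix.trace_fin_two_of]
  linear_combination hcos + hprod - 2 * hsin
end

section
/- Let θ₀, θ_t, θ_* ∈ ℂ and s₁, s₂ ∈ ℂ ∖ {0}. Set e_* = e^{iπθ_*}, p₀ = 2cos2πθ₀, p_t = 2cos2πθ_t, A₊ = e_*⁻¹·p₀ + e_*·p_t, A₋ = e_*·p₀ + e_*⁻¹·p_t, A_* = e_*² + e_*⁻² + p₀·p_t. Let X₊, X₋ ∈ ℂ, define V = (p_t − e_*⁻¹·X₊ − e_*·X₋)·e_*⁻¹·s₁⁻¹, W = (e_*·X₊ + e_*⁻¹·X₋ − p₀)·e_*⁻¹·s₂⁻¹, and X_σ = e_*⁻² + e_*²·(1 + s₁·s₂). If X₊·X₋ − V·W = 1, then (X_σ, X₊, X₋) satisfies the monodromy cubic: X_σ·X₊·X₋ + X₊² + X₋² − X_σ − A₊·X₊ − A₋·X₋ + A_* = 0. -/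
open Complex Real

/-- The parameterized monodromy data of Painlevé V satisfy the cubic equation of the
monodromy manifold, given the unit-determinant condition `X₊X₋ − VW = 1`. -/
theorem monodromy_data_satisfy_cubic
    (θ0 θt θs : ℂ) (s1 s2 : ℂ) (hs1 : s1 ≠ 0) (hs2 : s2 ≠ 0)
    (p0 pt es Ap Am As : ℂ)
    (hes : es = Complex.exp (I * (π : ℂ) * θs))
    (hp0 : p0 = 2 * Complex.cos (2 * (π : ℂ) * θ0))
    (hpt : pt = 2 * Complex.cos (2 * (π : ℂ) * θt))
    (hAp : Ap = es⁻¹ * p0 + es * pt)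
    (hAm : Am = es * p0 + es⁻¹ * pt)
    (hAs : As = es ^ 2 + es⁻¹ ^ 2 + p0 * pt)
    (Xp Xm V W Xσ : ℂ)
    (hV : V = (pt - es⁻¹ * Xp - es * Xm) * es⁻¹ * s1⁻¹)
    (hW : W = (es * Xp + es⁻¹ * Xm - p0) * es⁻¹ * s2⁻¹)
    (hXσ : Xσ = es⁻¹ ^ 2 + es ^ 2 * (1 + s1 * s2))
    (hdet : Xp * Xm - V * W = 1) :
    Xσ * Xp * Xm + Xp ^ 2 + Xm ^ 2 - Xσ - Ap * Xp - Am * Xm + As = 0 := by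
  have he : es ≠ 0 := hes ▸ Complex.exp_ne_zero _
  have key : es ^ 2 * s1 * s2 * (V * W) =
      (pt - es⁻¹ * Xp - es * Xm) * (es * Xp + es⁻¹ * Xm - p0) := by
    rw [hV, hW]
    field_simp
  have hf : es * es⁻¹ = 1 := mul_inv_cancel₀ he
  rw [hXσ, hAp, hAm, hAs]
  generalize es⁻¹ = f at *
  linear_combination es ^ 2 * s1 * s2 * hdet + key - (Xp ^ 2 + Xm ^ 2) * hf
end

section
/- Let θ₀, θ_t, θ_* ∈ ℂ and set e_* = e^{iπθ_*}, p₀ = 2cos2πθ₀, p_t = 2cos2πθ_t, A₊ = e_*⁻¹·p₀ + e_*·p_t, A₋ = e_*·p₀ + e_*⁻¹·p_t, A_* = e_*² + e_*⁻² + p₀·p_t. If X_σ = e_*² + e_*⁻², then for all X₊, X₋ ∈ ℂ the cubic equation X_σ·X₊·X₋ + X₊² + X₋² − X_σ − A₊·X₊ − A₋·X₋ + A_* = 0 holds if and only if e_*·X₊ + e_*⁻¹·X₋ = p₀ or e_*⁻¹·X₊ + e_*·X₋ = p_t; i.e., for this value of X_σ the cubic splits into a union of two lines. -/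
open Complex Real

/-- For `X_σ = e_*² + e_*⁻²` (i.e. `s₁s₂ = 0`), the monodromy cubic of Painlevé V
splits into a union of two lines. -/
theorem monodromy_cubic_splits
    (θ0 θt θs : ℂ)
    (p0 pt es Ap Am As : ℂ)
    (hes : es = Complex.exp (I * (π : ℂ) * θs))
    (hp0 : p0 = 2 * Complex.cos (2 * (π : ℂ) * θ0))
    (hpt : pt = 2 * Complex.cos (2 * (π : ℂ) * θt))
    (hAp : Ap = es⁻¹ * p0 + es * pt)
    (hAm : Am = es * p0 + es⁻¹ * pt)
    (hAs : As = es ^ 2 + es⁻¹ ^ 2 + p0 * pt)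
    (Xσ : ℂ) (hXσ : Xσ = es ^ 2 + es⁻¹ ^ 2) :
    ∀ Xp Xm : ℂ,
      Xσ * Xp * Xm + Xp ^ 2 + Xm ^ 2 - Xσ - Ap * Xp - Am * Xm + As = 0 ↔
        (es * Xp + es⁻¹ * Xm = p0 ∨ es⁻¹ * Xp + es * Xm = pt) := by
  intro Xp Xm
  have h0 : es ≠ 0 := by rw [hes]; exact Complex.exp_ne_zero _
  have h1 : es * es⁻¹ = 1 := mul_inv_cancel₀ h0
  have key : Xσ * Xp * Xm + Xp ^ 2 + Xm ^ 2 - Xσ - Ap * Xp - Am * Xm + As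
      = (es * Xp + es⁻¹ * Xm - p0) * (es⁻¹ * Xp + es * Xm - pt) := by
    rw [hAp, hAm, hAs, hXσ]
    linear_combination (-(Xp ^ 2) - Xm ^ 2) * h1
  rw [key, mul_eq_zero, sub_eq_zero, sub_eq_zero]
end

section
/- Let σ, η, θ₀, θ_t, θ_* ∈ ℂ with sin2πσ ≠ 0, and let X₊, X₋ be defined by the relations 2·X_±·sin²2πσ = A_± − A_∓·cos2πσ ∓ 2i·Σ_{ε=±1} e^{2πiεη ∓ iπεσ}·(cos2π(θ_t−εσ) − cos2πθ₀)·sinπ(θ_*−εσ). If moreover X₊·X₋ ≠ 1, then cos2πσ = (e^{iπθ_*}·X₊ + e^{−iπθ_*}·X₋ − 2cos2πθ₀)·(e^{−iπθ_*}·X₊ + e^{iπθ_*}·X₋ − 2cos2πθ_t) / (2·(1 − X₊·X₋)) + cos2πθ_*. -/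
open Complex Real

/-- Purely algebraic core of the identity. -/
theorem cos_sigma_aux (C S c0 ct st cs p q s r n m U V X Y : ℂ) (hS : S ≠ 0)
    (hpq : p * q = 1) (hsr : s * r = 1) (hnm : n * m = 1)
    (hC : 2 * C = s ^ 2 + r ^ 2) (hcs : 2 * cs = p ^ 2 + q ^ 2)
    (hCS : S ^ 2 = 1 - C ^ 2) (hst : st ^ 2 = 1 - ct ^ 2)
    (hUV : 2 * (U * V) = ((ct * C + st * S - c0) * (ct * C - st * S - c0)) * (C - cs))
    (hX : 2 * X * S ^ 2 = (2 * q * c0 + 2 * p * ct) - (2 * p * c0 + 2 * q * ct) * C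
      - 2 * I * (n * r * U + m * s * V))
    (hY : 2 * Y * S ^ 2 = (2 * p * c0 + 2 * q * ct) - (2 * q * c0 + 2 * p * ct) * C
      + 2 * I * (n * s * U + m * r * V)) :
    (p * X + q * Y - 2 * c0) * (q * X + p * Y - 2 * ct) = 2 * (C - cs) * (1 - X * Y) := by
  have hI : I ^ 2 = -1 := I_sq
  obtain ⟨A, hA⟩ : ∃ A, A = 2 * q * c0 + 2 * p * ct := ⟨_, rfl⟩
  obtain ⟨B, hB⟩ : ∃ B, B = 2 * p * c0 + 2 * q * ct := ⟨_, rfl⟩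
  rw [← hA, ← hB] at hX hY
  obtain ⟨x, hx⟩ : ∃ x, x = - 2 * I * (n * r * U + m * s * V) := ⟨_, rfl⟩
  obtain ⟨y, hy⟩ : ∃ y, y = 2 * I * (n * s * U + m * r * V) := ⟨_, rfl⟩
  have hX' : 2 * X * S ^ 2 = A - B * C + x := by rw [hX, hx]; ring
  have hY' : 2 * Y * S ^ 2 = B - A * C + y := by rw [hY, hy]
  have e1 : x ^ 2 + y ^ 2 + 2 * C * (x * y) = -16 * S ^ 2 * (U * V) := by
    have h1 : x ^ 2 = -4 * (n ^ 2 * r ^ 2 * U ^ 2 + m ^ 2 * s ^ 2 * V ^ 2 + 2 * (U * V)) := by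
      have : (n * m) * (s * r) = 1 := by rw [hnm, hsr, one_mul]
      rw [hx]
      linear_combination 4 * (n * r * U + m * s * V) ^ 2 * hI - 8 * U * V * this
    have h2 : y ^ 2 = -4 * (n ^ 2 * s ^ 2 * U ^ 2 + m ^ 2 * r ^ 2 * V ^ 2 + 2 * (U * V)) := by
      have : (n * m) * (s * r) = 1 := by rw [hnm, hsr, one_mul]
      rw [hy]
      linear_combination 4 * (n * s * U + m * r * V) ^ 2 * hI - 8 * U * V * this
    have h3 : x * y = 4 * (n ^ 2 * U ^ 2 + m ^ 2 * V ^ 2 + 2 * C * (U * V)) := by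
      rw [hx, hy]
      linear_combination -4 * (n * r * U + m * s * V) * (n * s * U + m * r * V) * hI
        + 4 * (n ^ 2 * U ^ 2 + m ^ 2 * V ^ 2) * hsr + 4 * U * V * (s ^ 2 + r ^ 2) * hnm
        - 4 * U * V * hC
    rw [h1, h2, h3]
    linear_combination 4 * (n ^ 2 * U ^ 2 + m ^ 2 * V ^ 2) * hC + 16 * U * V * hCS
  have e2 : 16 * (U * V) + A ^ 2 + B ^ 2 - 2 * C * (A * B)
      = 4 * S ^ 2 * (4 * c0 * ct - 2 * C + 2 * cs) := by
    have h1 : A ^ 2 + B ^ 2 = 8 * cs * (c0 ^ 2 + ct ^ 2) + 16 * c0 * ct := by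
      rw [hA, hB]
      linear_combination -4 * (c0 ^ 2 + ct ^ 2) * hcs + 16 * c0 * ct * hpq
    have h2 : A * B = 4 * (c0 ^ 2 + ct ^ 2) + 8 * c0 * ct * cs := by
      rw [hA, hB]
      linear_combination -4 * c0 * ct * hcs + 4 * (c0 ^ 2 + ct ^ 2) * hpq
    have h3 : (ct * C + st * S - c0) * (ct * C - st * S - c0)
        = (ct * C - c0) ^ 2 - (1 - ct ^ 2) * (1 - C ^ 2) := by
      rw [← hst, ← hCS]; ring
    rw [h3] at hUV
    rw [hCS, h2]
    linear_combination 8 * hUV + h1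
  have e3 : X ^ 2 + Y ^ 2 + 2 * C * (X * Y) - A * X - B * Y + 4 * c0 * ct - 2 * C + 2 * cs = 0 := by
    have hS4 : 4 * S ^ 4 ≠ 0 := mul_ne_zero (by norm_num) (pow_ne_zero 4 hS)
    apply (mul_eq_zero.mp _).resolve_left hS4
    have hx2 : x = 2 * X * S ^ 2 - A + B * C := by rw [hX']; ring
    have hy2 : y = 2 * Y * S ^ 2 - B + A * C := by rw [hY']; ring
    rw [hx2, hy2] at e1
    linear_combination e1 - S ^ 2 * e2 + (8 * C * X * Y * 0 + 4 * S ^ 2 * (A * X + B * Y) * (-1) + (A ^ 2 + B ^ 2 - 2 * C * A * B)) * hCS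
  rw [hA, hB] at e3
  linear_combination e3 - X * Y * hcs + (X ^ 2 + Y ^ 2) * hpq

/-- Recovering the exponent `σ` from the monodromy coordinates `(X₊, X₋)` of
Painlevé V parameterized by `(σ, η)`. -/
theorem cos_sigma_from_X
    (σ η θ0 θt θs : ℂ)
    (hσ : Complex.sin (2 * (π : ℂ) * σ) ≠ 0)
    (Ap Am Xp Xm : ℂ)
    (hAp : Ap = 2 * Complex.exp (-I * (π : ℂ) * θs) * Complex.cos (2 * (π : ℂ) * θ0)
      + 2 * Complex.exp (I * (π : ℂ) * θs) * Complex.cos (2 * (π : ℂ) * θt))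
    (hAm : Am = 2 * Complex.exp (I * (π : ℂ) * θs) * Complex.cos (2 * (π : ℂ) * θ0)
      + 2 * Complex.exp (-I * (π : ℂ) * θs) * Complex.cos (2 * (π : ℂ) * θt))
    (hXp : 2 * Xp * Complex.sin (2 * (π : ℂ) * σ) ^ 2 =
      Ap - Am * Complex.cos (2 * (π : ℂ) * σ)
        - 2 * I * (Complex.exp (2 * (π : ℂ) * I * η - I * (π : ℂ) * σ)
            * (Complex.cos (2 * (π : ℂ) * (θt - σ)) - Complex.cos (2 * (π : ℂ) * θ0))
            * Complex.sin ((π : ℂ) * (θs - σ))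
          + Complex.exp (-(2 * (π : ℂ) * I * η) + I * (π : ℂ) * σ)
            * (Complex.cos (2 * (π : ℂ) * (θt + σ)) - Complex.cos (2 * (π : ℂ) * θ0))
            * Complex.sin ((π : ℂ) * (θs + σ))))
    (hXm : 2 * Xm * Complex.sin (2 * (π : ℂ) * σ) ^ 2 =
      Am - Ap * Complex.cos (2 * (π : ℂ) * σ)
        + 2 * I * (Complex.exp (2 * (π : ℂ) * I * η + I * (π : ℂ) * σ)
            * (Complex.cos (2 * (π : ℂ) * (θt - σ)) - Complex.cos (2 * (π : ℂ) * θ0))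
            * Complex.sin ((π : ℂ) * (θs - σ))
          + Complex.exp (-(2 * (π : ℂ) * I * η) - I * (π : ℂ) * σ)
            * (Complex.cos (2 * (π : ℂ) * (θt + σ)) - Complex.cos (2 * (π : ℂ) * θ0))
            * Complex.sin ((π : ℂ) * (θs + σ))))
    (hXX : Xp * Xm ≠ 1) :
    Complex.cos (2 * (π : ℂ) * σ) =
      (Complex.exp (I * (π : ℂ) * θs) * Xp + Complex.exp (-I * (π : ℂ) * θs) * Xm
          - 2 * Complex.cos (2 * (π : ℂ) * θ0))
        * (Complex.exp (-I * (π : ℂ) * θs) * Xp + Complex.exp (I * (π : ℂ) * θs) * Xm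
          - 2 * Complex.cos (2 * (π : ℂ) * θt))
        / (2 * (1 - Xp * Xm))
      + Complex.cos (2 * (π : ℂ) * θs) := by
  have hpi : ∀ z : ℂ, Complex.exp z * Complex.exp (-z) = 1 := fun z => by
    rw [← Complex.exp_add, add_neg_cancel, Complex.exp_zero]
  have hcos : ∀ z : ℂ, 2 * Complex.cos (2 * (π : ℂ) * z)
      = Complex.exp (I * π * z) ^ 2 + Complex.exp (-(I * π * z)) ^ 2 := fun z => by
    rw [Complex.two_cos, ← Complex.exp_nat_mul, ← Complex.exp_nat_mul]
    congr 2 <;> push_cast <;> ring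
  have hneg : -I * (π : ℂ) * θs = -(I * π * θs) := by ring
  have key := cos_sigma_aux (Complex.cos (2 * π * σ)) (Complex.sin (2 * π * σ))
    (Complex.cos (2 * π * θ0)) (Complex.cos (2 * π * θt)) (Complex.sin (2 * π * θt))
    (Complex.cos (2 * π * θs)) (Complex.exp (I * π * θs)) (Complex.exp (-(I * π * θs)))
    (Complex.exp (I * π * σ)) (Complex.exp (-(I * π * σ)))
    (Complex.exp (2 * π * I * η)) (Complex.exp (-(2 * π * I * η)))
    ((Complex.cos (2 * π * (θt - σ)) - Complex.cos (2 * π * θ0)) * Complex.sin (π * (θs - σ)))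
    ((Complex.cos (2 * π * (θt + σ)) - Complex.cos (2 * π * θ0)) * Complex.sin (π * (θs + σ)))
    Xp Xm hσ (hpi _) (hpi _) (hpi _) (hcos σ) (hcos θs)
    (Complex.sin_sq _) (Complex.sin_sq _) ?_ ?_ ?_
  · have h1 : (1 - Xp * Xm) ≠ 0 := fun h => hXX (by linear_combination -h)
    rw [hneg, key]
    field_simp
    ring
  · have a1 : 2 * (π : ℂ) * (θt - σ) = 2 * π * θt - 2 * π * σ := by ring
    have a2 : 2 * (π : ℂ) * (θt + σ) = 2 * π * θt + 2 * π * σ := by ring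
    have a3 : 2 * (Complex.sin (π * (θs - σ)) * Complex.sin (π * (θs + σ)))
        = Complex.cos (2 * π * σ) - Complex.cos (2 * π * θs) := by
      have b1 : 2 * (π : ℂ) * σ = π * (θs + σ) - π * (θs - σ) := by ring
      have b2 : 2 * (π : ℂ) * θs = π * (θs + σ) + π * (θs - σ) := by ring
      rw [b1, b2, Complex.cos_sub, Complex.cos_add]
      ring
    rw [← a3, a1, a2, Complex.cos_sub, Complex.cos_add]
    ring
  · rw [hXp, hAp, hAm, hneg, sub_eq_add_neg (2 * (π : ℂ) * I * η), Complex.exp_add,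
      Complex.exp_add]
    ring
  · rw [hXm, hAp, hAm, hneg, sub_eq_add_neg (-(2 * (π : ℂ) * I * η)), Complex.exp_add,
      Complex.exp_add]
    ring
end

section
/- Let σ, η, θ₀, θ_t, θ_* ∈ ℂ with sin2πσ ≠ 0, and let X₊, X₋ be defined by the relations 2·X_±·sin²2πσ = A_± − A_∓·cos2πσ ∓ 2i·Σ_{ε=±1} e^{2πiεη ∓ iπεσ}·(cos2π(θ_t−εσ) − cos2πθ₀)·sinπ(θ_*−εσ). If sinπ(θ₀+θ_t−σ)·sinπ(θ_t−θ₀−σ)·sinπ(θ_*−σ) ≠ 0, then e^{2πiη} = [ sin2πσ·(e^{−iπσ}·X₊ + e^{iπσ}·X₋) + 2cos2πθ₀·sinπ(θ_*−σ) − 2cos2πθ_t·sinπ(θ_*+σ) ] / [ 4·sinπ(θ₀+θ_t−σ)·sinπ(θ_t−θ₀−σ)·sinπ(θ_*−σ) ]. -/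
open Complex Real

/-- Recovering the twist parameter `η` from the monodromy coordinates `(X₊, X₋)` of
Painlevé V parameterized by `(σ, η)`. -/
theorem exp_eta_from_X
    (σ η θ0 θt θs : ℂ)
    (hσ : Complex.sin (2 * (π : ℂ) * σ) ≠ 0)
    (Ap Am Xp Xm : ℂ)
    (hAp : Ap = 2 * Complex.exp (-I * (π : ℂ) * θs) * Complex.cos (2 * (π : ℂ) * θ0)
      + 2 * Complex.exp (I * (π : ℂ) * θs) * Complex.cos (2 * (π : ℂ) * θt))
    (hAm : Am = 2 * Complex.exp (I * (π : ℂ) * θs) * Complex.cos (2 * (π : ℂ) * θ0)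
      + 2 * Complex.exp (-I * (π : ℂ) * θs) * Complex.cos (2 * (π : ℂ) * θt))
    (hXp : 2 * Xp * Complex.sin (2 * (π : ℂ) * σ) ^ 2 =
      Ap - Am * Complex.cos (2 * (π : ℂ) * σ)
        - 2 * I * (Complex.exp (2 * (π : ℂ) * I * η - I * (π : ℂ) * σ)
            * (Complex.cos (2 * (π : ℂ) * (θt - σ)) - Complex.cos (2 * (π : ℂ) * θ0))
            * Complex.sin ((π : ℂ) * (θs - σ))
          + Complex.exp (-(2 * (π : ℂ) * I * η) + I * (π : ℂ) * σ)
            * (Complex.cos (2 * (π : ℂ) * (θt + σ)) - Complex.cos (2 * (π : ℂ) * θ0))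
            * Complex.sin ((π : ℂ) * (θs + σ))))
    (hXm : 2 * Xm * Complex.sin (2 * (π : ℂ) * σ) ^ 2 =
      Am - Ap * Complex.cos (2 * (π : ℂ) * σ)
        + 2 * I * (Complex.exp (2 * (π : ℂ) * I * η + I * (π : ℂ) * σ)
            * (Complex.cos (2 * (π : ℂ) * (θt - σ)) - Complex.cos (2 * (π : ℂ) * θ0))
            * Complex.sin ((π : ℂ) * (θs - σ))
          + Complex.exp (-(2 * (π : ℂ) * I * η) - I * (π : ℂ) * σ)
            * (Complex.cos (2 * (π : ℂ) * (θt + σ)) - Complex.cos (2 * (π : ℂ) * θ0))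
            * Complex.sin ((π : ℂ) * (θs + σ))))
    (hden : Complex.sin ((π : ℂ) * (θ0 + θt - σ)) * Complex.sin ((π : ℂ) * (θt - θ0 - σ))
      * Complex.sin ((π : ℂ) * (θs - σ)) ≠ 0) :
    Complex.exp (2 * (π : ℂ) * I * η) =
      (Complex.sin (2 * (π : ℂ) * σ)
          * (Complex.exp (-I * (π : ℂ) * σ) * Xp + Complex.exp (I * (π : ℂ) * σ) * Xm)
        + 2 * Complex.cos (2 * (π : ℂ) * θ0) * Complex.sin ((π : ℂ) * (θs - σ))
        - 2 * Complex.cos (2 * (π : ℂ) * θt) * Complex.sin ((π : ℂ) * (θs + σ)))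
      / (4 * Complex.sin ((π : ℂ) * (θ0 + θt - σ))
          * Complex.sin ((π : ℂ) * (θt - θ0 - σ))
          * Complex.sin ((π : ℂ) * (θs - σ))) := by
  have hD : Complex.cos (2 * (π : ℂ) * (θt - σ)) - Complex.cos (2 * (π : ℂ) * θ0) =
      -2 * Complex.sin ((π : ℂ) * (θ0 + θt - σ)) * Complex.sin ((π : ℂ) * (θt - θ0 - σ)) := by
    rw [Complex.cos_sub_cos]
    congr 2
    · congr 2
      ring
    · ring
  have e1 : Complex.exp (2 * (π : ℂ) * I * η - I * (π : ℂ) * σ) =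
      Complex.exp (2 * (π : ℂ) * I * η) * Complex.exp (-I * (π : ℂ) * σ) := by
    rw [← Complex.exp_add]; congr 1; ring
  have e2 : Complex.exp (2 * (π : ℂ) * I * η + I * (π : ℂ) * σ) =
      Complex.exp (2 * (π : ℂ) * I * η) * Complex.exp (I * (π : ℂ) * σ) := by
    rw [← Complex.exp_add]
  have e3 : Complex.exp (-(2 * (π : ℂ) * I * η) + I * (π : ℂ) * σ) =
      Complex.exp (-(2 * (π : ℂ) * I * η)) * Complex.exp (I * (π : ℂ) * σ) := by
    rw [← Complex.exp_add]
  have e4 : Complex.exp (-(2 * (π : ℂ) * I * η) - I * (π : ℂ) * σ) =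
      Complex.exp (-(2 * (π : ℂ) * I * η)) * Complex.exp (-I * (π : ℂ) * σ) := by
    rw [← Complex.exp_add]; congr 1; ring
  have hss : Complex.exp (I * (π : ℂ) * σ) * Complex.exp (-I * (π : ℂ) * σ) = 1 := by
    rw [← Complex.exp_add, ← Complex.exp_zero]; congr 1; ring
  have hS : Complex.sin (2 * (π : ℂ) * σ) =
      (Complex.exp (-I * (π : ℂ) * σ) ^ 2 - Complex.exp (I * (π : ℂ) * σ) ^ 2) * I / 2 := by
    rw [Complex.sin, ← Complex.exp_nat_mul, ← Complex.exp_nat_mul]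
    congr 3 <;> congr 1 <;> push_cast <;> ring
  have hC : Complex.cos (2 * (π : ℂ) * σ) =
      (Complex.exp (I * (π : ℂ) * σ) ^ 2 + Complex.exp (-I * (π : ℂ) * σ) ^ 2) / 2 := by
    rw [Complex.cos, ← Complex.exp_nat_mul, ← Complex.exp_nat_mul]
    congr 2 <;> congr 1 <;> push_cast <;> ring
  have ha : Complex.sin ((π : ℂ) * (θs - σ)) =
      (Complex.exp (-I * (π : ℂ) * θs) * Complex.exp (I * (π : ℂ) * σ)
        - Complex.exp (I * (π : ℂ) * θs) * Complex.exp (-I * (π : ℂ) * σ)) * I / 2 := by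
    rw [Complex.sin, ← Complex.exp_add, ← Complex.exp_add]
    congr 3 <;> congr 1 <;> ring
  have hb : Complex.sin ((π : ℂ) * (θs + σ)) =
      (Complex.exp (-I * (π : ℂ) * θs) * Complex.exp (-I * (π : ℂ) * σ)
        - Complex.exp (I * (π : ℂ) * θs) * Complex.exp (I * (π : ℂ) * σ)) * I / 2 := by
    rw [Complex.sin, ← Complex.exp_add, ← Complex.exp_add]
    congr 3 <;> congr 1 <;> ring
  have hden' : 4 * Complex.sin ((π : ℂ) * (θ0 + θt - σ)) * Complex.sin ((π : ℂ) * (θt - θ0 - σ))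
      * Complex.sin ((π : ℂ) * (θs - σ)) ≠ 0 := by
    intro h
    apply hden
    linear_combination h / 4
  rw [eq_div_iff hden']
  apply mul_left_cancel₀ hσ
  rw [hD, e1, e3] at hXp
  rw [hD, e2, e4] at hXm
  have hI : I ^ 2 = -1 := Complex.I_sq
  generalize Complex.exp (I * (π : ℂ) * σ) = s at *
  generalize Complex.exp (-I * (π : ℂ) * σ) = s' at *
  generalize Complex.exp (I * (π : ℂ) * θs) = u at *
  generalize Complex.exp (-I * (π : ℂ) * θs) = u' at *
  generalize Complex.sin (2 * (π : ℂ) * σ) = S at *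
  generalize Complex.cos (2 * (π : ℂ) * σ) = C at *
  generalize Complex.sin ((π : ℂ) * (θs - σ)) = a at *
  generalize Complex.sin ((π : ℂ) * (θs + σ)) = b at *
  generalize Complex.exp (2 * (π : ℂ) * I * η) = E at *
  generalize Complex.exp (-(2 * (π : ℂ) * I * η)) = E' at *
  generalize Complex.cos (2 * (π : ℂ) * θ0) = c0 at *
  generalize Complex.cos (2 * (π : ℂ) * θt) = ct at *
  generalize Complex.cos (2 * (π : ℂ) * (θt + σ)) = d at *
  generalize Complex.sin ((π : ℂ) * (θ0 + θt - σ)) = f at *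
  generalize Complex.sin ((π : ℂ) * (θt - θ0 - σ)) = g at *
  have k1 : s' - s * C = -I * s * S := by
    rw [hS, hC]
    linear_combination (-s') * hss + (s * s' ^ 2 - s ^ 3) / 2 * hI
  have k2 : s - s' * C = I * s' * S := by
    rw [hS, hC]
    linear_combination (-s) * hss - (s' ^ 3 - s ^ 2 * s') / 2 * hI
  have k3 : u * s' - s * u' = 2 * I * a := by
    rw [ha]
    linear_combination (u * s' - u' * s) * hI
  have k4 : u' * s' - s * u = -2 * I * b := by
    rw [hb]
    linear_combination (u' * s' - u * s) * hI
  have k5 : s ^ 2 - s' ^ 2 = 2 * I * S := by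
    rw [hS]
    linear_combination (s ^ 2 - s' ^ 2) * hI
  have k6 : s' * (Ap - Am * C) + s * (Am - Ap * C) = -4 * S * (c0 * a - ct * b) := by
    have : s' * (Ap - Am * C) + s * (Am - Ap * C) = I * S * (s' * Am - s * Ap) := by
      linear_combination Ap * k1 + Am * k2
    rw [this, hAp, hAm]
    linear_combination 2 * I * S * c0 * k3 + 2 * I * S * ct * k4
      + 4 * S * (c0 * a - ct * b) * hI
  linear_combination (-1 / 2) * (s' * hXp + s * hXm + k6)
    + 2 * I * E * f * g * a * k5 + 4 * E * f * g * a * S * hI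
end

section
/- Let σ, η, θ₀, θ_t, θ_* ∈ ℂ with sin2πσ ≠ 0, and let X₊, X₋ be defined by the relations 2·X_±·sin²2πσ = A_± − A_∓·cos2πσ ∓ 2i·Σ_{ε=±1} e^{2πiεη ∓ iπεσ}·(cos2π(θ_t−εσ) − cos2πθ₀)·sinπ(θ_*−εσ). Define R_± = (A₊ − A₋·cos2πσ − 2·sin²2πσ·X₋·e^{∓2πiσ})·(−i)·e^{±iπσ}·sinπ(θ_*∓σ)·sinπ(θ_t∓σ+θ₀)·sinπ(θ_t∓σ−θ₀), and R₀ = (cos²2πθ₀ + cos²2πθ_t)·(1 + cos²2πσ − 2cos2πσ·cos2πθ_*) − sin⁴2πσ + 2cos2πθ₀·cos2πθ_t·(cos2πθ_*·(1+cos²2πσ) − 2cos2πσ). Then R₊·e^{2πiη} + R₋·e^{−2πiη} + R₀ = −sin⁴2πσ·(1 − X₊·X₋). -/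
open Complex Real

theorem cos_sub_cos_aux (a b : ℂ) :
    Complex.cos (2 * (π : ℂ) * a) - Complex.cos (2 * (π : ℂ) * b)
      = -2 * (Complex.sin ((π : ℂ) * (a + b)) * Complex.sin ((π : ℂ) * (a - b))) := by
  rw [Complex.cos_sub_cos]
  have h1 : (2 * (π : ℂ) * a + 2 * (π : ℂ) * b) / 2 = (π : ℂ) * (a + b) := by ring
  have h2 : (2 * (π : ℂ) * a - 2 * (π : ℂ) * b) / 2 = (π : ℂ) * (a - b) := by ring
  rw [h1, h2]; ring

/-- The identity `R₊ e^{2πiη} + R₋ e^{−2πiη} + R₀ = −sin⁴2πσ (1 − X₊X₋)`, which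
identifies the long-distance parameter `e^{2πiρ} = 1 − X₊X₋` on the imaginary axis. -/
theorem R_identity
    (σ η θ0 θt θs : ℂ)
    (hσ : Complex.sin (2 * (π : ℂ) * σ) ≠ 0)
    (Ap Am Xp Xm : ℂ)
    (hAp : Ap = 2 * Complex.exp (-I * (π : ℂ) * θs) * Complex.cos (2 * (π : ℂ) * θ0)
      + 2 * Complex.exp (I * (π : ℂ) * θs) * Complex.cos (2 * (π : ℂ) * θt))
    (hAm : Am = 2 * Complex.exp (I * (π : ℂ) * θs) * Complex.cos (2 * (π : ℂ) * θ0)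
      + 2 * Complex.exp (-I * (π : ℂ) * θs) * Complex.cos (2 * (π : ℂ) * θt))
    (hXp : 2 * Xp * Complex.sin (2 * (π : ℂ) * σ) ^ 2 =
      Ap - Am * Complex.cos (2 * (π : ℂ) * σ)
        - 2 * I * (Complex.exp (2 * (π : ℂ) * I * η - I * (π : ℂ) * σ)
            * (Complex.cos (2 * (π : ℂ) * (θt - σ)) - Complex.cos (2 * (π : ℂ) * θ0))
            * Complex.sin ((π : ℂ) * (θs - σ))
          + Complex.exp (-(2 * (π : ℂ) * I * η) + I * (π : ℂ) * σ)
            * (Complex.cos (2 * (π : ℂ) * (θt + σ)) - Complex.cos (2 * (π : ℂ) * θ0))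
            * Complex.sin ((π : ℂ) * (θs + σ))))
    (hXm : 2 * Xm * Complex.sin (2 * (π : ℂ) * σ) ^ 2 =
      Am - Ap * Complex.cos (2 * (π : ℂ) * σ)
        + 2 * I * (Complex.exp (2 * (π : ℂ) * I * η + I * (π : ℂ) * σ)
            * (Complex.cos (2 * (π : ℂ) * (θt - σ)) - Complex.cos (2 * (π : ℂ) * θ0))
            * Complex.sin ((π : ℂ) * (θs - σ))
          + Complex.exp (-(2 * (π : ℂ) * I * η) - I * (π : ℂ) * σ)
            * (Complex.cos (2 * (π : ℂ) * (θt + σ)) - Complex.cos (2 * (π : ℂ) * θ0))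
            * Complex.sin ((π : ℂ) * (θs + σ))))
    (Rp Rm R0 : ℂ)
    (hRp : Rp = (Ap - Am * Complex.cos (2 * (π : ℂ) * σ)
        - 2 * Complex.sin (2 * (π : ℂ) * σ) ^ 2 * Xm * Complex.exp (-(2 * (π : ℂ) * I * σ)))
      * (-I) * Complex.exp (I * (π : ℂ) * σ) * Complex.sin ((π : ℂ) * (θs - σ))
      * Complex.sin ((π : ℂ) * (θt - σ + θ0)) * Complex.sin ((π : ℂ) * (θt - σ - θ0)))
    (hRm : Rm = (Ap - Am * Complex.cos (2 * (π : ℂ) * σ)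
        - 2 * Complex.sin (2 * (π : ℂ) * σ) ^ 2 * Xm * Complex.exp (2 * (π : ℂ) * I * σ))
      * (-I) * Complex.exp (-I * (π : ℂ) * σ) * Complex.sin ((π : ℂ) * (θs + σ))
      * Complex.sin ((π : ℂ) * (θt + σ + θ0)) * Complex.sin ((π : ℂ) * (θt + σ - θ0)))
    (hR0 : R0 = (Complex.cos (2 * (π : ℂ) * θ0) ^ 2 + Complex.cos (2 * (π : ℂ) * θt) ^ 2)
        * (1 + Complex.cos (2 * (π : ℂ) * σ) ^ 2
            - 2 * Complex.cos (2 * (π : ℂ) * σ) * Complex.cos (2 * (π : ℂ) * θs))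
      - Complex.sin (2 * (π : ℂ) * σ) ^ 4
      + 2 * Complex.cos (2 * (π : ℂ) * θ0) * Complex.cos (2 * (π : ℂ) * θt)
        * (Complex.cos (2 * (π : ℂ) * θs) * (1 + Complex.cos (2 * (π : ℂ) * σ) ^ 2)
            - 2 * Complex.cos (2 * (π : ℂ) * σ))) :
    Rp * Complex.exp (2 * (π : ℂ) * I * η) + Rm * Complex.exp (-(2 * (π : ℂ) * I * η)) + R0
      = -(Complex.sin (2 * (π : ℂ) * σ) ^ 4) * (1 - Xp * Xm) := by
  have hcs : Complex.cos (2 * (π : ℂ) * θs)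
      = (Complex.exp (I * (π : ℂ) * θs) ^ 2 + Complex.exp (-I * (π : ℂ) * θs) ^ 2) / 2 := by
    rw [← Complex.exp_nat_mul, ← Complex.exp_nat_mul, Complex.cos]
    congr 3 <;> (push_cast; ring)
  have hu : Complex.exp (I * (π : ℂ) * θs) * Complex.exp (-I * (π : ℂ) * θs) = 1 := by
    rw [← Complex.exp_add, ← Complex.exp_zero]; congr 1; ring
  have hq : Complex.exp (I * (π : ℂ) * σ) * Complex.exp (-I * (π : ℂ) * σ) = 1 := by
    rw [← Complex.exp_add, ← Complex.exp_zero]; congr 1; ring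
  have e1 : Complex.exp (-(2 * (π : ℂ) * I * σ)) = Complex.exp (-I * (π : ℂ) * σ) ^ 2 := by
    rw [← Complex.exp_nat_mul]; congr 1; push_cast; ring
  have e2 : Complex.exp (2 * (π : ℂ) * I * σ) = Complex.exp (I * (π : ℂ) * σ) ^ 2 := by
    rw [← Complex.exp_nat_mul]; congr 1; push_cast; ring
  have e3 : Complex.exp (2 * (π : ℂ) * I * η - I * (π : ℂ) * σ)
      = Complex.exp (2 * (π : ℂ) * I * η) * Complex.exp (-I * (π : ℂ) * σ) := by
    rw [← Complex.exp_add]; congr 1; ring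
  have e4 : Complex.exp (-(2 * (π : ℂ) * I * η) - I * (π : ℂ) * σ)
      = Complex.exp (-(2 * (π : ℂ) * I * η)) * Complex.exp (-I * (π : ℂ) * σ) := by
    rw [← Complex.exp_add]; congr 1; ring
  rw [e3, Complex.exp_add, cos_sub_cos_aux, cos_sub_cos_aux] at hXp
  rw [e4, Complex.exp_add, cos_sub_cos_aux, cos_sub_cos_aux] at hXm
  rw [e1] at hRp
  rw [e2] at hRm
  rw [hcs] at hR0
  clear hcs e1 e2 e3 e4 hσ
  generalize Complex.sin (2 * (π : ℂ) * σ) = s at *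
  generalize Complex.cos (2 * (π : ℂ) * σ) = c at *
  generalize Complex.cos (2 * (π : ℂ) * θ0) = c0 at *
  generalize Complex.cos (2 * (π : ℂ) * θt) = ct at *
  generalize Complex.exp (I * (π : ℂ) * θs) = u at *
  generalize Complex.exp (-I * (π : ℂ) * θs) = v at *
  generalize Complex.exp (I * (π : ℂ) * σ) = q at *
  generalize Complex.exp (-I * (π : ℂ) * σ) = r at *
  generalize Complex.exp (2 * (π : ℂ) * I * η) = E at *
  generalize Complex.exp (-(2 * (π : ℂ) * I * η)) = F at *
  generalize Complex.sin ((π : ℂ) * (θs - σ)) = a1 at *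
  generalize Complex.sin ((π : ℂ) * (θs + σ)) = a2 at *
  generalize Complex.sin ((π : ℂ) * (θt - σ + θ0)) = b1 at *
  generalize Complex.sin ((π : ℂ) * (θt - σ - θ0)) = b2 at *
  generalize Complex.sin ((π : ℂ) * (θt + σ + θ0)) = d1 at *
  generalize Complex.sin ((π : ℂ) * (θt + σ - θ0)) = d2 at *
  -- M = 2 s² X₋, with the two η-terms T₊, T₋
  obtain ⟨Tp, hTp⟩ : ∃ T, T = -2 * (E * a1 * b1 * b2) := ⟨_, rfl⟩
  obtain ⟨Tm, hTm⟩ : ∃ T, T = -2 * (F * a2 * d1 * d2) := ⟨_, rfl⟩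
  obtain ⟨M, hM⟩ : ∃ M, M = 2 * Xm * s ^ 2 := ⟨_, rfl⟩
  obtain ⟨P, hP⟩ : ∃ P, P = 2 * Xp * s ^ 2 := ⟨_, rfl⟩
  have hP' : P = Ap - Am * c - 2 * I * (Tp * r + Tm * q) := by
    rw [hP, hXp, hTp, hTm]; ring
  have hM' : M = Am - Ap * c + 2 * I * (Tp * q + Tm * r) := by
    rw [hM, hXm, hTp, hTm]; ring
  have h1 : Rp * E = I / 2 * ((Ap - Am * c) * q - M * r) * Tp := by
    rw [hRp, hTp, hM]
    linear_combination (2 * s ^ 2 * Xm * r * I * a1 * b1 * b2 * E) * hq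
  have h2 : Rm * F = I / 2 * ((Ap - Am * c) * r - M * q) * Tm := by
    rw [hRm, hTm, hM]
    linear_combination (2 * s ^ 2 * Xm * q * I * a2 * d1 * d2 * F) * hq
  have h3 : R0 + s ^ 4 = (Ap - Am * c) * (Am - Ap * c) / 4 := by
    rw [hR0, hAp, hAm]
    linear_combination (2 * c * 2 * c0 * ct - (1 + c ^ 2) * (c0 ^ 2 + ct ^ 2)) * hu
  have h4 : -(s ^ 4) * (1 - Xp * Xm) = -s ^ 4 + P * M / 4 := by
    rw [hP, hM]; ring
  rw [h4, h1, h2, hP']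
  linear_combination h3 - (Ap - Am * c) / 4 * hM'
end

section
/- Define the following maps ℂ⁴ → ℂ⁴: s₀(a,b,c,d) = (−a,b,c,d); s_t(a,b,c,d) = (a,−b,c,d); s₁(a,b,c,d) = (a,b,−c,d); s_∞(a,b,c,d) = (a,b,c,−d); and s_δ(a,b,c,d) = (a−δ, b−δ, c−δ, d−δ) where δ = (a+b+c+d)/2. Then the composition s_δ ∘ s_t ∘ s₀ ∘ s_δ ∘ s₁ ∘ s_δ ∘ s_t ∘ s₀ ∘ s_δ (applying the rightmost s_δ first) equals s_∞, i.e. the map (a,b,c,d) ↦ (a,b,c,−d). -/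
/-- Sign flip of the first momentum. -/
def s0 : ℂ × ℂ × ℂ × ℂ → ℂ × ℂ × ℂ × ℂ := fun (a, b, c, d) => (-a, b, c, d)

/-- Sign flip of the second momentum. -/
def st : ℂ × ℂ × ℂ × ℂ → ℂ × ℂ × ℂ × ℂ := fun (a, b, c, d) => (a, -b, c, d)

/-- Sign flip of the third momentum. -/
def s1 : ℂ × ℂ × ℂ × ℂ → ℂ × ℂ × ℂ × ℂ := fun (a, b, c, d) => (a, b, -c, d)

/-- Sign flip of the fourth momentum. -/
def sInf : ℂ × ℂ × ℂ × ℂ → ℂ × ℂ × ℂ × ℂ := fun (a, b, c, d) => (a, b, c, -d)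

/-- The Regge–Okamoto transformation. -/
noncomputable def sDelta : ℂ × ℂ × ℂ × ℂ → ℂ × ℂ × ℂ × ℂ := fun (a, b, c, d) =>
  ((a - (a + b + c + d) / 2), (b - (a + b + c + d) / 2),
    (c - (a + b + c + d) / 2), (d - (a + b + c + d) / 2))

/-- The fourth sign flip `s_∞` lies in the group generated by `s₀`, `s_t`, `s₁`, `s_δ`:
`s_δ ∘ s_t ∘ s₀ ∘ s_δ ∘ s₁ ∘ s_δ ∘ s_t ∘ s₀ ∘ s_δ = s_∞`. -/
theorem sInf_from_generators :
    sDelta ∘ st ∘ s0 ∘ sDelta ∘ s1 ∘ sDelta ∘ st ∘ s0 ∘ sDelta = sInf := by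
  funext ⟨a, b, c, d⟩
  simp only [Function.comp_apply, sDelta, st, s0, s1, _root_.sInf, Prod.mk.injEq]
  refine ⟨?_, ?_, ?_, ?_⟩ <;> ring
end

section
/- Define A₊(θ₀, θ_t, θ_*) = 2e^{−iπθ_*}cos2πθ₀ + 2e^{iπθ_*}cos2πθ_t and A₋(θ₀, θ_t, θ_*) = 2e^{iπθ_*}cos2πθ₀ + 2e^{−iπθ_*}cos2πθ_t as functions ℂ³ → ℂ. Then both A₊ and A₋ are invariant under the three maps s₀(θ₀, θ_t, θ_*) = (−θ₀, θ_t, θ_*), s_t(θ₀, θ_t, θ_*) = (θ₀, −θ_t, θ_*), and s_δ(θ₀, θ_t, θ_*) = (θ₀−δ, θ_t−δ, θ_*−2δ) with δ = (θ₀+θ_t+θ_*)/2; that is, A_±(s(θ₀,θ_t,θ_*)) = A_±(θ₀,θ_t,θ_*) for s ∈ {s₀, s_t, s_δ} and all (θ₀,θ_t,θ_*) ∈ ℂ³. -/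
open Complex Real

/-- The combination `A₊ = 2e^{−iπθ_*}cos2πθ₀ + 2e^{iπθ_*}cos2πθ_t`. -/
noncomputable def Aplus : ℂ × ℂ × ℂ → ℂ := fun (θ0, θt, θs) =>
  2 * Complex.exp (-I * (π : ℂ) * θs) * Complex.cos (2 * (π : ℂ) * θ0)
    + 2 * Complex.exp (I * (π : ℂ) * θs) * Complex.cos (2 * (π : ℂ) * θt)

/-- The combination `A₋ = 2e^{iπθ_*}cos2πθ₀ + 2e^{−iπθ_*}cos2πθ_t`. -/
noncomputable def Aminus : ℂ × ℂ × ℂ → ℂ := fun (θ0, θt, θs) =>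
  2 * Complex.exp (I * (π : ℂ) * θs) * Complex.cos (2 * (π : ℂ) * θ0)
    + 2 * Complex.exp (-I * (π : ℂ) * θs) * Complex.cos (2 * (π : ℂ) * θt)

/-- Sign flip `s₀`. -/
def flip0 : ℂ × ℂ × ℂ → ℂ × ℂ × ℂ := fun (θ0, θt, θs) => (-θ0, θt, θs)

/-- Sign flip `s_t`. -/
def flipt : ℂ × ℂ × ℂ → ℂ × ℂ × ℂ := fun (θ0, θt, θs) => (θ0, -θt, θs)

/-- The Regge–Okamoto transformation `s_δ`. -/
noncomputable def flipδ : ℂ × ℂ × ℂ → ℂ × ℂ × ℂ := fun (θ0, θt, θs) =>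
  (θ0 - (θ0 + θt + θs) / 2, θt - (θ0 + θt + θs) / 2, θs - 2 * ((θ0 + θt + θs) / 2))

theorem two_exp_mul_cos_aux (x y : ℂ) :
    2 * Complex.exp x * Complex.cos y = Complex.exp (x + y * I) + Complex.exp (x - y * I) := by
  rw [Complex.cos, sub_eq_add_neg, Complex.exp_add, Complex.exp_add, neg_mul]
  ring

/-- `A₊` and `A₋` are invariant under the Weyl group generators `s₀`, `s_t`, `s_δ`. -/
theorem Apm_weyl_invariant :
    ∀ p : ℂ × ℂ × ℂ,
      (Aplus (flip0 p) = Aplus p ∧ Aplus (flipt p) = Aplus p ∧ Aplus (flipδ p) = Aplus p) ∧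
      (Aminus (flip0 p) = Aminus p ∧ Aminus (flipt p) = Aminus p ∧
        Aminus (flipδ p) = Aminus p) := by
  rintro ⟨a, b, s⟩
  refine ⟨⟨?_, ?_, ?_⟩, ?_, ?_, ?_⟩
  · simp [Aplus, flip0]
  · simp [Aplus, flipt]
  · simp only [Aplus, flipδ, two_exp_mul_cos_aux]
    ring_nf
  · simp [Aminus, flip0]
  · simp [Aminus, flipt]
  · simp only [Aminus, flipδ, two_exp_mul_cos_aux]
    ring_nf
end

section
/- For (θ₀, θ_t, θ₁, θ_∞) ∈ ℂ⁴, set p_ν = 2cos2πθ_ν for ν ∈ {0, t, 1, ∞} and define ω_{0t} = p₀p_t + p₁p_∞, ω_{1t} = p₁p_t + p₀p_∞, ω_{01} = p₀p₁ + p_t p_∞. Then ω_{0t}, ω_{1t} and ω_{01} are each invariant under the four maps s₀(a,b,c,d) = (−a,b,c,d), s_t(a,b,c,d) = (a,−b,c,d), s₁(a,b,c,d) = (a,b,−c,d), and s_δ(a,b,c,d) = (a−δ,b−δ,c−δ,d−δ) with δ = (a+b+c+d)/2, where (a,b,c,d) = (θ₀, θ_t, θ₁, θ_∞). -/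
open Complex Real

/-- `ω_{0t} = p₀p_t + p₁p_∞` with `p_ν = 2cos2πθ_ν`. -/
noncomputable def ω0t : ℂ × ℂ × ℂ × ℂ → ℂ := fun (θ0, θt, θ1, θi) =>
  (2 * Complex.cos (2 * (π : ℂ) * θ0)) * (2 * Complex.cos (2 * (π : ℂ) * θt))
    + (2 * Complex.cos (2 * (π : ℂ) * θ1)) * (2 * Complex.cos (2 * (π : ℂ) * θi))

/-- `ω_{1t} = p₁p_t + p₀p_∞` with `p_ν = 2cos2πθ_ν`. -/
noncomputable def ω1t : ℂ × ℂ × ℂ × ℂ → ℂ := fun (θ0, θt, θ1, θi) =>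
  (2 * Complex.cos (2 * (π : ℂ) * θ1)) * (2 * Complex.cos (2 * (π : ℂ) * θt))
    + (2 * Complex.cos (2 * (π : ℂ) * θ0)) * (2 * Complex.cos (2 * (π : ℂ) * θi))

/-- `ω_{01} = p₀p₁ + p_tp_∞` with `p_ν = 2cos2πθ_ν`. -/
noncomputable def ω01 : ℂ × ℂ × ℂ × ℂ → ℂ := fun (θ0, θt, θ1, θi) =>
  (2 * Complex.cos (2 * (π : ℂ) * θ0)) * (2 * Complex.cos (2 * (π : ℂ) * θ1))
    + (2 * Complex.cos (2 * (π : ℂ) * θt)) * (2 * Complex.cos (2 * (π : ℂ) * θi))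

theorem two_cos_mul (x y : ℂ) : (2 * Complex.cos x) * (2 * Complex.cos y)
    = 2 * Complex.cos (x + y) + 2 * Complex.cos (x - y) := by
  rw [Complex.cos_add, Complex.cos_sub]; ring

/-- The pairing identity behind invariance under `s_δ`. -/
theorem pair_shift (k a b c d e : ℂ) (he : 2 * e = a + b + c + d) :
    (2 * Complex.cos (k * (a - e))) * (2 * Complex.cos (k * (b - e)))
      + (2 * Complex.cos (k * (c - e))) * (2 * Complex.cos (k * (d - e)))
    = (2 * Complex.cos (k * a)) * (2 * Complex.cos (k * b))
      + (2 * Complex.cos (k * c)) * (2 * Complex.cos (k * d)) := by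
  simp only [two_cos_mul]
  have h1 : k * (a - e) + k * (b - e) = -(k * c + k * d) := by linear_combination -k * he
  have h2 : k * (c - e) + k * (d - e) = -(k * a + k * b) := by linear_combination -k * he
  have h3 : k * (a - e) - k * (b - e) = k * a - k * b := by ring
  have h4 : k * (c - e) - k * (d - e) = k * c - k * d := by ring
  rw [h1, h2, h3, h4, Complex.cos_neg, Complex.cos_neg]
  ring

/-- `ω_{0t}`, `ω_{1t}`, `ω_{01}` are invariant under the `W(D₄)` generators
`s₀`, `s_t`, `s₁`, `s_δ`. -/
theorem omega_weyl_invariant :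
    ∀ p : ℂ × ℂ × ℂ × ℂ,
      (ω0t (s0 p) = ω0t p ∧ ω0t (st p) = ω0t p ∧ ω0t (s1 p) = ω0t p ∧
        ω0t (sDelta p) = ω0t p) ∧
      (ω1t (s0 p) = ω1t p ∧ ω1t (st p) = ω1t p ∧ ω1t (s1 p) = ω1t p ∧
        ω1t (sDelta p) = ω1t p) ∧
      (ω01 (s0 p) = ω01 p ∧ ω01 (st p) = ω01 p ∧ ω01 (s1 p) = ω01 p ∧
        ω01 (sDelta p) = ω01 p) := by
  rintro ⟨a, b, c, d⟩
  refine ⟨⟨?_, ?_, ?_, ?_⟩, ⟨?_, ?_, ?_, ?_⟩, ⟨?_, ?_, ?_, ?_⟩⟩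
  case refine_4 => exact pair_shift _ a b c d _ (by ring)
  case refine_8 => exact pair_shift _ c b a d _ (by ring)
  case refine_12 => exact pair_shift _ a c b d _ (by ring)
  all_goals simp only [ω0t, ω1t, ω01, s0, st, s1, mul_neg, Complex.cos_neg]
end

section
/- Let σ, θ_* ∈ ℂ with 2σ ∉ ℤ, σ + θ_* ∉ ℤ and σ − θ_* ∉ ℤ, and let ρ₀, τ₀ ∈ ℂ ∖ {0}. Define s₁ = −2πi·ρ₀²·τ₀⁻² / (Γ(σ−θ_*)·Γ(1−σ−θ_*)), s₂ = −2πi·ρ₀⁻²·τ₀²·e^{−2πiθ_*} / (Γ(θ_*+σ)·Γ(1+θ_*−σ)), the matrices S₁ = [[1, s₁],[0, 1]], S₂ = [[1, 0],[s₂, 1]], M_∞ = S₁ · diag(e^{−2πiθ_*}, e^{2πiθ_*}) · S₂, and the connection matrix U = [[ Γ(−2σ)·e^{iπ(θ_*−σ)}·ρ₀·τ₀⁻¹ / Γ(−θ_*−σ), −Γ(2σ)·e^{iπ(θ_*+σ)}·ρ₀·τ₀⁻¹ / Γ(−θ_*+σ) ],[ −(θ_*+σ)·Γ(−2σ)·ρ₀⁻¹·τ₀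 / Γ(1+θ_*−σ), Γ(2σ)·ρ₀⁻¹·τ₀ / Γ(θ_*+σ) ]]. Then M_∞ · U = U · diag(e^{−2πiσ}, e^{2πiσ}); i.e., U diagonalizes the monodromy at infinity, M_∞ = U·e^{−2πi𝔖}·U⁻¹ with 𝔖 = diag(σ, −σ). -/
open Complex Matrix Real

/-- The connection matrix `U` diagonalizes the monodromy at infinity of the Painlevé V
linear system: `M_∞ · U = U · diag(e^{−2πiσ}, e^{2πiσ})`. -/
theorem connection_matrix_diagonalizes_monodromy
    (σ θs : ℂ)
    (h0 : ∀ n : ℤ, 2 * σ ≠ (n : ℂ))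
    (h1 : ∀ n : ℤ, σ + θs ≠ (n : ℂ)) (h2 : ∀ n : ℤ, σ - θs ≠ (n : ℂ))
    (ρ0 τ0 : ℂ) (hρ0 : ρ0 ≠ 0) (hτ0 : τ0 ≠ 0)
    (s1 s2 : ℂ)
    (hs1 : s1 = -2 * (π : ℂ) * I * ρ0 ^ 2 * τ0⁻¹ ^ 2 /
      (Complex.Gamma (σ - θs) * Complex.Gamma (1 - σ - θs)))
    (hs2 : s2 = -2 * (π : ℂ) * I * ρ0⁻¹ ^ 2 * τ0 ^ 2 * Complex.exp (-2 * (π : ℂ) * I * θs) /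
      (Complex.Gamma (θs + σ) * Complex.Gamma (1 + θs - σ)))
    (Minf U : Matrix (Fin 2) (Fin 2) ℂ)
    (hMinf : Minf = !![1, s1; 0, 1] *
      !![Complex.exp (-2 * (π : ℂ) * I * θs), 0; 0, Complex.exp (2 * (π : ℂ) * I * θs)] *
      !![1, 0; s2, 1])
    (hU : U = !![
      Complex.Gamma (-2 * σ) * Complex.exp (I * (π : ℂ) * (θs - σ)) * ρ0 * τ0⁻¹ /
        Complex.Gamma (-θs - σ),
      -(Complex.Gamma (2 * σ) * Complex.exp (I * (π : ℂ) * (θs + σ)) * ρ0 * τ0⁻¹ /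
        Complex.Gamma (-θs + σ));
      -((θs + σ) * Complex.Gamma (-2 * σ) * ρ0⁻¹ * τ0 / Complex.Gamma (1 + θs - σ)),
      Complex.Gamma (2 * σ) * ρ0⁻¹ * τ0 / Complex.Gamma (θs + σ)]) :
    Minf * U = U * !![Complex.exp (-2 * (π : ℂ) * I * σ), 0;
      0, Complex.exp (2 * (π : ℂ) * I * σ)] := by
  have hp : (2 * (π : ℂ) * I) ≠ 0 := by
    simp [Real.pi_ne_zero]
  have hA : Complex.Gamma (σ - θs) ≠ 0 := Complex.Gamma_ne_zero fun m h => by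
    apply h2 (-m); rw [h]; push_cast; ring
  have hB : Complex.Gamma (1 - σ - θs) ≠ 0 := Complex.Gamma_ne_zero fun m h => by
    apply h1 (1 + m); push_cast; linear_combination -h
  have hC : Complex.Gamma (θs + σ) ≠ 0 := Complex.Gamma_ne_zero fun m h => by
    apply h1 (-m); push_cast; linear_combination h
  have hD : Complex.Gamma (1 + θs - σ) ≠ 0 := Complex.Gamma_ne_zero fun m h => by
    apply h2 (1 + m); push_cast; linear_combination -h
  have hst : θs + σ ≠ 0 := fun h => h1 0 (by push_cast; linear_combination h)
  have hB' : Complex.Gamma (-θs - σ) ≠ 0 := Complex.Gamma_ne_zero fun m h => by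
    apply h1 m; push_cast; linear_combination -h
  have hBB : Complex.Gamma (1 - σ - θs) = -(θs + σ) * Complex.Gamma (-θs - σ) := by
    have h := Complex.Gamma_add_one (-θs - σ) (fun h => hst (by linear_combination -h))
    rw [show (1 - σ - θs) = -θs - σ + 1 by ring, h]; ring
  have hAD := Complex.Gamma_mul_Gamma_one_sub (σ - θs)
  have hCB := Complex.Gamma_mul_Gamma_one_sub (θs + σ)
  rw [show 1 - (σ - θs) = 1 + θs - σ by ring] at hAD
  rw [show 1 - (θs + σ) = 1 - σ - θs by ring] at hCB
  have ha : Complex.exp (I * π * θs) ≠ 0 := Complex.exp_ne_zero _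
  have hb : Complex.exp (I * π * σ) ≠ 0 := Complex.exp_ne_zero _
  have e1 : Complex.exp (-2 * (π : ℂ) * I * θs) = (Complex.exp (I * π * θs))⁻¹ ^ 2 := by
    rw [← Complex.exp_neg, ← Complex.exp_nat_mul]; congr 1; push_cast; ring
  have e2 : Complex.exp (2 * (π : ℂ) * I * θs) = (Complex.exp (I * π * θs)) ^ 2 := by
    rw [← Complex.exp_nat_mul]; congr 1; push_cast; ring
  have e3 : Complex.exp (-2 * (π : ℂ) * I * σ) = (Complex.exp (I * π * σ))⁻¹ ^ 2 := by
    rw [← Complex.exp_neg, ← Complex.exp_nat_mul]; congr 1; push_cast; ring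
  have e4 : Complex.exp (2 * (π : ℂ) * I * σ) = (Complex.exp (I * π * σ)) ^ 2 := by
    rw [← Complex.exp_nat_mul]; congr 1; push_cast; ring
  have e5 : Complex.exp (I * π * (θs - σ)) =
      Complex.exp (I * π * θs) * (Complex.exp (I * π * σ))⁻¹ := by
    rw [← Complex.exp_neg, ← Complex.exp_add]; congr 1; ring
  have e6 : Complex.exp (I * π * (θs + σ)) =
      Complex.exp (I * π * θs) * Complex.exp (I * π * σ) := by
    rw [← Complex.exp_add]; congr 1; ring
  have k1 : Complex.sin (π * (σ - θs)) * (2 * I) =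
      Complex.exp (I * π * σ) * (Complex.exp (I * π * θs))⁻¹ -
      Complex.exp (I * π * θs) * (Complex.exp (I * π * σ))⁻¹ := by
    rw [← Complex.exp_neg, ← Complex.exp_neg, ← Complex.exp_add, ← Complex.exp_add, Complex.sin,
      show -(π * (σ - θs)) * I = I * π * θs + -(I * π * σ) by ring,
      show (π * (σ - θs)) * I = I * π * σ + -(I * π * θs) by ring]
    linear_combination (-Complex.exp (I * π * σ + -(I * π * θs))
      + Complex.exp (I * π * θs + -(I * π * σ))) * I_sq
  have k2 : Complex.sin (π * (θs + σ)) * (2 * I) =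
      Complex.exp (I * π * σ) * Complex.exp (I * π * θs) -
      (Complex.exp (I * π * θs))⁻¹ * (Complex.exp (I * π * σ))⁻¹ := by
    rw [← Complex.exp_neg, ← Complex.exp_neg, ← Complex.exp_add, ← Complex.exp_add, Complex.sin,
      show -(π * (θs + σ)) * I = -(I * π * θs) + -(I * π * σ) by ring,
      show (π * (θs + σ)) * I = I * π * σ + (I * π * θs) by ring]
    linear_combination (-Complex.exp (I * π * σ + (I * π * θs))
      + Complex.exp (-(I * π * θs) + -(I * π * σ))) * I_sq
  have hs1' : Complex.sin (π * (σ - θs)) ≠ 0 := by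
    intro h; rw [h, div_zero] at hAD; exact mul_ne_zero hA hD hAD
  have hs2' : Complex.sin (π * (θs + σ)) ≠ 0 := by
    intro h; rw [h, div_zero] at hCB; exact mul_ne_zero hC hB hCB
  have q1 : 2 * π * I = Complex.Gamma (σ - θs) * Complex.Gamma (1 + θs - σ) *
      (Complex.sin (π * (σ - θs)) * (2 * I)) := by
    rw [hAD]; field_simp
  have q2 : 2 * π * I = Complex.Gamma (θs + σ) * Complex.Gamma (1 - σ - θs) *
      (Complex.sin (π * (θs + σ)) * (2 * I)) := by
    rw [hCB]; field_simp
  rw [k1] at q1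
  rw [k2, hBB] at q2
  rw [show -2 * (π : ℂ) * I = -(2 * π * I) by ring] at hs1 hs2
  rw [show -(2 * (π : ℂ) * I) * θs = -2 * (π : ℂ) * I * θs by ring, e1] at hs2
  rw [hBB] at hs1
  rw [e1, e2] at hMinf
  rw [e5, e6, show -θs + σ = σ - θs by ring] at hU
  rw [e3, e4]
  subst hMinf hU
  clear e1 e2 e3 e4 e5 e6 k1 k2 hs1' hs2' hAD hCB hBB hB h0 h1 h2
  generalize Complex.exp (I * π * θs) = a at *
  generalize Complex.exp (I * π * σ) = b at *
  generalize Complex.Gamma (σ - θs) = A at *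
  generalize Complex.Gamma (-θs - σ) = B at *
  generalize Complex.Gamma (θs + σ) = C at *
  generalize Complex.Gamma (1 + θs - σ) = D at *
  generalize Complex.Gamma (2 * σ) = G at *
  generalize Complex.Gamma (-2 * σ) = H at *
  generalize 2 * (π : ℂ) * I = p at *
  generalize θs + σ = x at *
  have hab : b ^ 2 * a ^ 2 - 1 ≠ 0 := by
    intro h; apply hp; rw [q2]; field_simp; linear_combination (-C * x * B) * h
  have hba : b ^ 2 - a ^ 2 ≠ 0 := by
    intro h; apply hp; rw [q1]; field_simp; linear_combination (A * D) * h
  have hCe : C = -p * a * b / (x * B * (b ^ 2 * a ^ 2 - 1)) := by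
    rw [q2]; field_simp
  have hDe : D = p * a * b / (A * (b ^ 2 - a ^ 2)) := by
    rw [q1]; field_simp
  clear q1 q2
  subst hs1 hs2
  subst hCe hDe
  ext i j
  fin_cases i <;> fin_cases j <;> simp [Matrix.mul_apply, Fin.sum_univ_two] <;> field_simp <;> ring
end
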